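/- arXiv:2202.06456 — 2 statements merged into one kernel-verified Lean document; each statement's English description precedes it below -/
import Mathlib

section
/- Fix complex numbers $a_2 \ne 0$, $b_2 \ne 0$, $b_0$, and $p, r, y_1, y_2$, and let $n \ge 1$ be an integer such that $2n + r - 4$, $2n + r - 3$, $2n + r - 2$, and $2n + r - 1$ are all nonzero. Set $a_1 = (r-1)a_2$, $b_1 = (p-1)b_2$, $d_1 = a_2\big(b_2((y_1-1)(y_2-1)(p+r-y_1-y_2-2) + (r-1)(p-2)) - (r-1)b_0\big)$, $d_2 = a_2\big(b_2((y_1+y_2)(p+r-y_1-y_2-1) + y_1 y_2 - r(p-1)) - b_0\big)$. Define $x_k = b_0 + b_1 k + b_2 k^2$, $h_k = a_1 k + a_2 k^2$, $e_k = d_1 k + d_2 k^2$, $g_0 = 0$, $g_k = x_{k-1}(h_k - h_0) + e_k$ for $k \ge 1$, and $\alpha_n = \frac{g_n}{h_{n-1} - h_n}\left( \frac{g_{n-1}}{h_{n-2} - h_n} - \frac{g_n}{h_{n-1} - h_n} + \frac{g_{n+1}}{h_{n-1} - h_{n+1}} + x_n - x_{n-1} \right)$. Then $\alpha_n = \frac{b_2^2\,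 n (n+y_1-1)(n+y_2-1)(n-p+y_1+y_2)(n-2+r)(n+r-y_1-1)(n+r-y_2-1)(n+p+r-y_1-y_2-2)}{(2n+r-3)(2n+r-2)^2(2n+r-1)}$ (the Wilson-polynomial recurrence coefficient). -/
open Finset

/-- Case 1 (`a₂ ≠ 0`, `b₂ ≠ 0`): under the parameter substitution (24), the recurrence
coefficient `α_n` of equation (15) equals the Wilson-polynomial recurrence coefficient
of equation (49). -/
theorem case1_alpha_is_wilson (a2 b2 b0 p r y1 y2 : ℂ) (n : ℕ) (hn : 1 ≤ n)
    (ha2 : a2 ≠ 0) (hb2 : b2 ≠ 0)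
    (h4 : 2 * (n : ℂ) + r - 4 ≠ 0) (h3 : 2 * (n : ℂ) + r - 3 ≠ 0)
    (h2 : 2 * (n : ℂ) + r - 2 ≠ 0) (h1 : 2 * (n : ℂ) + r - 1 ≠ 0)
    (a1 b1 d1 d2 : ℂ)
    (ha1 : a1 = (r - 1) * a2)
    (hb1 : b1 = (p - 1) * b2)
    (hd1 : d1 = a2 * (b2 * ((y1 - 1) * (y2 - 1) * (p + r - y1 - y2 - 2) +
      (r - 1) * (p - 2)) - (r - 1) * b0))
    (hd2 : d2 = a2 * (b2 * ((y1 + y2) * (p + r - y1 - y2 - 1) + y1 * y2 -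
      r * (p - 1)) - b0))
    (x h e g : ℕ → ℂ)
    (hx : ∀ k : ℕ, x k = b0 + b1 * k + b2 * (k : ℂ) ^ 2)
    (hhk : ∀ k : ℕ, h k = a1 * k + a2 * (k : ℂ) ^ 2)
    (he : ∀ k : ℕ, e k = d1 * k + d2 * (k : ℂ) ^ 2)
    (hg0 : g 0 = 0)
    (hgk : ∀ k : ℕ, 1 ≤ k → g k = x (k - 1) * (h k - h 0) + e k)
    (α : ℂ)
    (hα : α = g n / (h (n - 1) - h n) *
      (g (n - 1) / (h (n - 2) - h n) - g n / (h (n - 1) - h n) +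
        g (n + 1) / (h (n - 1) - h (n + 1)) + x n - x (n - 1))) :
    α = b2 ^ 2 * n * ((n : ℂ) + y1 - 1) * ((n : ℂ) + y2 - 1) * ((n : ℂ) - p + y1 + y2) *
        ((n : ℂ) - 2 + r) * ((n : ℂ) + r - y1 - 1) * ((n : ℂ) + r - y2 - 1) *
        ((n : ℂ) + p + r - y1 - y2 - 2) /
      ((2 * (n : ℂ) + r - 3) * (2 * (n : ℂ) + r - 2) ^ 2 * (2 * (n : ℂ) + r - 1)) := by
  have hG : ∀ k : ℕ, g k = a2 * b2 * (k * (k + y1 - 1) * (k + y2 - 1) *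
      (k + p + r - y1 - y2 - 2)) := by
    intro k
    rcases k with _ | k
    · simp [hg0]
    · rw [hgk _ (by omega), hx, hhk, hhk, he, ha1, hb1, hd1, hd2]
      simp only [Nat.add_sub_cancel]
      push_cast
      ring
  obtain ⟨m, rfl⟩ : ∃ m, n = m + 1 := ⟨n - 1, by omega⟩
  have e1 : h (m + 1 - 1) - h (m + 1) = -(a2 * (2 * ((m + 1 : ℕ) : ℂ) + r - 2)) := by
    simp only [Nat.add_sub_cancel, hhk, ha1]
    push_cast
    ring
  have e3 : h (m + 1 - 1) - h (m + 1 + 1) = -(2 * a2 * (2 * ((m + 1 : ℕ) : ℂ) + r - 1)) := by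
    simp only [Nat.add_sub_cancel, hhk, ha1]
    push_cast
    ring
  have e2 : g (m + 1 - 1) / (h (m + 1 - 2) - h (m + 1)) =
      g (m + 1 - 1) / (-(2 * a2 * (2 * ((m + 1 : ℕ) : ℂ) + r - 3))) := by
    rcases m with _ | m
    · simp [hg0]
    · congr 1
      rw [show m + 1 + 1 - 2 = m by omega, hhk, hhk, ha1]
      push_cast
      ring
  rw [hα, e2, e1, e3, hG, hG, hG, hx, hx, hb1]
  simp only [Nat.add_sub_cancel]
  push_cast at h1 h2 h3 ⊢
  generalize (m : ℂ) = z at *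
  obtain ⟨t, ht⟩ : ∃ t, t = 2 * (z + 1) + r - 2 := ⟨_, rfl⟩
  obtain rfl : r = t - 2 * z := by rw [ht]; ring
  have k1 : 2 * (z + 1) + (t - 2 * z) - 1 = t + 1 := by ring
  have k2 : 2 * (z + 1) + (t - 2 * z) - 2 = t := by ring
  have k3 : 2 * (z + 1) + (t - 2 * z) - 3 = t - 1 := by ring
  rw [k1] at h1
  rw [k2] at h2
  rw [k3] at h3
  rw [k1, k2, k3]
  clear hG e1 e2 e3
  field_simp
  ring
end

section
/- Fix complex numbers $a_2 \ne 0$, $b_1$, $b_0$, and $r, y_1, y_2$, and let $n \ge 1$ be an integer such that $2n + r - 4$, $2n + r - 3$, $2n + r - 2$, and $2n + r - 1$ are all nonzero. Set $b_2 = 0$, $a_1 = (r-1)a_2$, $d_1 = a_2\big(b_1(r-1 + (y_1-1)(y_2-1)) - b_0(r-1)\big)$, $d_2 = a_2\big(b_1(y_1+y_2-r) - b_0\big)$. Define $x_k = b_0 + b_1 k$, $h_k = a_1 k + a_2 k^2$, $e_k = d_1 k + d_2 k^2$, $g_0 = 0$, $g_k = x_{k-1}(h_k - h_0) + e_k$ for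 $k \ge 1$, and $\alpha_n = \frac{g_n}{h_{n-1} - h_n}\left( \frac{g_{n-1}}{h_{n-2} - h_n} - \frac{g_n}{h_{n-1} - h_n} + \frac{g_{n+1}}{h_{n-1} - h_{n+1}} + x_n - x_{n-1} \right)$. Then $\alpha_n = -\,\frac{b_1^2\, n (n+r-2)(n+y_1-1)(n+y_2-1)(n+r-y_1-1)(n+r-y_2-1)}{(2n+r-2)^2 (2n+r-3)(2n+r-1)}$ (the continuous-Hahn-type recurrence coefficient). -/
open Finset

/-- Case 2 (`b₂ = 0`, `a₂ ≠ 0`): under the parameter substitution (32), the recurrence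
coefficient `α_n` of equation (15) equals the continuous-Hahn-type recurrence
coefficient of equation (51). -/
theorem case2_alpha_is_continuous_hahn (a2 b1 b0 r y1 y2 : ℂ) (n : ℕ) (hn : 1 ≤ n)
    (ha2 : a2 ≠ 0)
    (h4 : 2 * (n : ℂ) + r - 4 ≠ 0) (h3 : 2 * (n : ℂ) + r - 3 ≠ 0)
    (h2 : 2 * (n : ℂ) + r - 2 ≠ 0) (h1 : 2 * (n : ℂ) + r - 1 ≠ 0)
    (a1 d1 d2 : ℂ)
    (ha1 : a1 = (r - 1) * a2)
    (hd1 : d1 = a2 * (b1 * (r - 1 + (y1 - 1) * (y2 - 1)) - b0 * (r - 1)))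
    (hd2 : d2 = a2 * (b1 * (y1 + y2 - r) - b0))
    (x h e g : ℕ → ℂ)
    (hx : ∀ k : ℕ, x k = b0 + b1 * k)
    (hhk : ∀ k : ℕ, h k = a1 * k + a2 * (k : ℂ) ^ 2)
    (he : ∀ k : ℕ, e k = d1 * k + d2 * (k : ℂ) ^ 2)
    (hg0 : g 0 = 0)
    (hgk : ∀ k : ℕ, 1 ≤ k → g k = x (k - 1) * (h k - h 0) + e k)
    (α : ℂ)
    (hα : α = g n / (h (n - 1) - h n) *
      (g (n - 1) / (h (n - 2) - h n) - g n / (h (n - 1) - h n) +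
        g (n + 1) / (h (n - 1) - h (n + 1)) + x n - x (n - 1))) :
    α = -(b1 ^ 2 * n * ((n : ℂ) + r - 2) * ((n : ℂ) + y1 - 1) * ((n : ℂ) + y2 - 1) *
        ((n : ℂ) + r - y1 - 1) * ((n : ℂ) + r - y2 - 1) /
      ((2 * (n : ℂ) + r - 2) ^ 2 * (2 * (n : ℂ) + r - 3) * (2 * (n : ℂ) + r - 1))) := by
  have hG : ∀ k : ℕ, g k = a2 * b1 * k * ((k : ℂ) + y1 - 1) * ((k : ℂ) + y2 - 1) := by
    intro k
    rcases k with _ | k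
    · simp [hg0]
    · rw [hgk (k + 1) (by omega), hx, hhk, hhk, he, ha1, hd1, hd2]
      simp only [Nat.add_sub_cancel]
      push_cast
      ring
  have hD1 : h (n - 1) - h n = -(a2 * (2 * (n : ℂ) + r - 2)) := by
    rw [hhk, hhk, ha1, Nat.cast_sub hn]
    push_cast
    ring
  have hD3 : h (n - 1) - h (n + 1) = -(2 * a2 * (2 * (n : ℂ) + r - 1)) := by
    rw [hhk, hhk, ha1, Nat.cast_sub hn]
    push_cast
    ring
  have hQ : g (n - 1) / (h (n - 2) - h n) =
      -(b1 * ((n : ℂ) - 1) * ((n : ℂ) + y1 - 2) * ((n : ℂ) + y2 - 2)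
        / (2 * (2 * (n : ℂ) + r - 3))) := by
    rcases Nat.lt_or_ge n 2 with hlt | hge
    · have hn1 : n = 1 := by omega
      subst hn1
      simp [hg0]
    · have hD2 : h (n - 2) - h n = -(2 * a2 * (2 * (n : ℂ) + r - 3)) := by
        rw [hhk, hhk, ha1, Nat.cast_sub hge]
        push_cast
        ring
      rw [hD2, hG, Nat.cast_sub hn]
      push_cast
      field_simp
      ring
  have hP : g n / (h (n - 1) - h n) =
      -(b1 * n * ((n : ℂ) + y1 - 1) * ((n : ℂ) + y2 - 1) / (2 * (n : ℂ) + r - 2)) := by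
    rw [hD1, hG]
    field_simp
  have hR : g (n + 1) / (h (n - 1) - h (n + 1)) =
      -(b1 * ((n : ℂ) + 1) * ((n : ℂ) + y1) * ((n : ℂ) + y2)
        / (2 * (2 * (n : ℂ) + r - 1))) := by
    rw [hD3, hG]
    push_cast
    field_simp
    ring
  have hX : x n = x (n - 1) + b1 := by
    rw [hx, hx, Nat.cast_sub hn]
    push_cast
    ring
  rw [hα, hQ, hP, hR, hX]
  clear hα hQ hP hR hX hD1 hD3 hG
  generalize (n : ℂ) = m at *
  obtain ⟨s, hs⟩ : ∃ s, s = 2 * m + r - 2 := ⟨_, rfl⟩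
  obtain ⟨u, hu⟩ : ∃ u, u = 2 * m + r - 3 := ⟨_, rfl⟩
  obtain ⟨v, hv⟩ : ∃ v, v = 2 * m + r - 1 := ⟨_, rfl⟩
  rw [← hs, ← hu, ← hv]
  rw [← hs] at h2
  rw [← hu] at h3
  rw [← hv] at h1
  have hr : r = s + 2 - 2 * m := by rw [hs]; ring
  have hu' : u = s - 1 := by rw [hu, hs]; ring
  have hv' : v = s + 1 := by rw [hv, hs]; ring
  clear hs hu hv
  field_simp
  rw [hr, hu', hv']
  ring
end
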